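/- For every symmetric matrix A ∈ Mat_n(ℤ) with even diagonal entries and det A ≠ 0 there exist m ∈ ℕ, a positive definite symmetric matrix B ∈ Mat_m(ℤ) with even diagonal entries, and an isomorphism of abelian groups ψ : ℤⁿ/Aℤⁿ → ℤᵐ/Bℤᵐ such that for all x ∈ ℤⁿ and y ∈ ℤᵐ with ψ([x]) = [y], one has xᵀA⁻¹x/2 − yᵀB⁻¹y/2 ∈ ℤ. (That is, every nondegenerate even lattice has the same discriminant form, including its ℚ/ℤ-valued quadratic form, as some positive definite even lattice.) -/

import Mathlib

open Matrix

namespace EvenLattice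

variable {n m l : Type*}

/-- Gram matrices of even lattices. -/
def IsEven (A : Matrix n n ℤ) : Prop :=
  A.IsSymm ∧ ∀ i, Even (A i i)

theorem IsEven.fromBlocks {A : Matrix n n ℤ} {B : Matrix m m ℤ} (hA : IsEven A) (hB : IsEven B) :
    IsEven (Matrix.fromBlocks A 0 0 B) :=
  ⟨hA.1.fromBlocks (by simp) hB.1, by rintro (i | i); exacts [hA.2 i, hB.2 i]⟩

theorem map_intCast_mul {R : Type*} [Ring R] {n m l : Type*} [Fintype m]
    (M : Matrix n m ℤ) (N : Matrix m l ℤ) :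
    (M * N).map (Int.cast : ℤ → R) =
      (M.map Int.cast : Matrix n m R) * (N.map Int.cast : Matrix m l R) :=
  Matrix.map_mul (f := Int.castRingHom R)

theorem map_intCast_mulVec {R : Type*} [Ring R] {n m : Type*} [Fintype m]
    (M : Matrix n m ℤ) (x : m → ℤ) :
    (fun i => ((M *ᵥ x) i : R)) = M.map Int.cast *ᵥ fun i => (x i : R) := by
  ext i
  simp [mulVec, dotProduct]

variable [Fintype n]

theorem intCast_dotProduct {R : Type*} [Ring R] (x y : n → ℤ) :
    ((x ⬝ᵥ y : ℤ) : R) = (fun i => (x i : R)) ⬝ᵥ fun i => (y i : R) := by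
  simp [dotProduct]

theorem det_map_intCast {R : Type*} [CommRing R] [DecidableEq n] (A : Matrix n n ℤ) :
    (A.map (Int.cast : ℤ → R)).det = (A.det : R) :=
  ((Int.castRingHom R).map_det A).symm

theorem isUnit_det_map_intCast {R : Type*} [Field R] [CharZero R] [DecidableEq n]
    {A : Matrix n n ℤ} (hA : A.det ≠ 0) : IsUnit (A.map (Int.cast : ℤ → R)).det := by
  rw [det_map_intCast, isUnit_iff_ne_zero]
  exact_mod_cast hA

theorem IsEven.even_dotProduct_mulVec {A : Matrix n n ℤ} (hA : IsEven A) (x : n → ℤ) :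
    Even (x ⬝ᵥ A *ᵥ x) := by
  classical
  have expand : x ⬝ᵥ A *ᵥ x = ∑ p : n × n, x p.1 * (A p.1 p.2 * x p.2) := by
    simp [dotProduct, mulVec, Fintype.sum_prod_type, Finset.mul_sum]
  rw [expand, even_iff_two_dvd, ← Nat.cast_two, ← ZMod.intCast_zmod_eq_zero_iff_dvd, Int.cast_sum]
  refine Finset.sum_involution (fun p _ => p.swap) ?_ ?_ (fun _ _ => Finset.mem_univ _)
    (fun p _ => p.swap_swap)
  · rintro ⟨i, j⟩ -
    have : x j * (A j i * x i) = x i * (A i j * x j) := by rw [hA.1.apply i j]; ring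
    simp only [Prod.swap, this]
    exact CharTwo.add_self_eq_zero _
  · rintro ⟨i, j⟩ - h hij
    obtain rfl : j = i := congrArg Prod.fst hij
    apply h
    rw [ZMod.intCast_zmod_eq_zero_iff_dvd, Nat.cast_two, ← even_iff_two_dvd]
    exact ((hA.2 j).mul_right _).mul_left _

theorem IsEven.transpose_mul_mul {A : Matrix n n ℤ} (hA : IsEven A) (P : Matrix n m ℤ) :
    IsEven (Pᵀ * A * P) := by
  refine ⟨?_, fun i => ?_⟩
  · simp [Matrix.IsSymm, Matrix.transpose_mul, hA.1.eq, Matrix.mul_assoc]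
  · have := hA.even_dotProduct_mulVec (fun j => P j i)
    rwa [Matrix.mul_assoc, Matrix.mul_apply_eq_vecMul]

variable [Fintype m]

/-- The discriminant forms of two Gram matrices are isomorphic. -/
def DiscEquiv [DecidableEq n] [DecidableEq m] (A : Matrix n n ℤ) (B : Matrix m m ℤ) : Prop :=
  ∃ ψ : ((n → ℤ) ⧸ LinearMap.range A.mulVecLin) ≃+ ((m → ℤ) ⧸ LinearMap.range B.mulVecLin),
    ∀ (x : n → ℤ) (y : m → ℤ),
      ψ (Submodule.Quotient.mk x) = Submodule.Quotient.mk y →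
      ∃ k : ℤ,
        ((fun i => (x i : ℚ)) ⬝ᵥ ((A.map (Int.cast : ℤ → ℚ))⁻¹).mulVec
            (fun i => (x i : ℚ))) / 2
        - ((fun i => (y i : ℚ)) ⬝ᵥ ((B.map (Int.cast : ℤ → ℚ))⁻¹).mulVec
            (fun i => (y i : ℚ))) / 2 = (k : ℚ)

variable [Fintype l] [DecidableEq n] [DecidableEq m] [DecidableEq l]

theorem DiscEquiv.symm {A : Matrix n n ℤ} {B : Matrix m m ℤ} (h : DiscEquiv A B) :
    DiscEquiv B A := by
  obtain ⟨ψ, hψ⟩ := h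
  refine ⟨ψ.symm, fun y x hxy => ?_⟩
  obtain ⟨k, hk⟩ := hψ x y (by rw [← hxy, ψ.apply_symm_apply])
  exact ⟨-k, by rw [Int.cast_neg, ← hk, neg_sub]⟩

theorem DiscEquiv.trans {A : Matrix n n ℤ} {B : Matrix m m ℤ} {C : Matrix l l ℤ}
    (h : DiscEquiv A B) (h' : DiscEquiv B C) : DiscEquiv A C := by
  obtain ⟨ψ, hψ⟩ := h
  obtain ⟨φ, hφ⟩ := h'
  refine ⟨ψ.trans φ, fun x z hxz => ?_⟩
  obtain ⟨y, hy⟩ := Submodule.Quotient.mk_surjective _ (ψ (Submodule.Quotient.mk x))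
  obtain ⟨k, hk⟩ := hψ x y hy.symm
  obtain ⟨k', hk'⟩ := hφ y z (by rw [hy, ← hxz]; rfl)
  exact ⟨k + k', by rw [Int.cast_add, ← hk, ← hk']; ring⟩

/-- Mutually inverse integral matrices modulo the lattices, compatible with the rational inverse
Gram matrices, induce an isomorphism of discriminant forms. -/
theorem DiscEquiv.of_matrices {A : Matrix n n ℤ} {B : Matrix m m ℤ} (hB : IsEven B)
    (hdet : B.det ≠ 0) (F : Matrix m n ℤ) (F' : Matrix n m ℤ)
    (hF : ∃ X : Matrix m n ℤ, F * A = B * X) (hF' : ∃ X : Matrix n m ℤ, F' * B = A * X)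
    (hFF' : ∃ X : Matrix n n ℤ, F' * F - 1 = A * X)
    (hF'F : ∃ X : Matrix m m ℤ, F * F' - 1 = B * X)
    (hinv : (F.map Int.cast : Matrix m n ℚ)ᵀ * (B.map Int.cast : Matrix m m ℚ)⁻¹ *
      (F.map Int.cast : Matrix m n ℚ) = (A.map (Int.cast : ℤ → ℚ))⁻¹) :
    DiscEquiv A B := by
  obtain ⟨X, hX⟩ := hF
  obtain ⟨X', hX'⟩ := hF'
  obtain ⟨Y, hY⟩ := hFF'
  obtain ⟨Y', hY'⟩ := hF'F
  have hle : LinearMap.range A.mulVecLin ≤ (LinearMap.range B.mulVecLin).comap F.mulVecLin := by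
    rintro _ ⟨v, rfl⟩
    exact ⟨X *ᵥ v, by simp [hX]⟩
  have hle' : LinearMap.range B.mulVecLin ≤ (LinearMap.range A.mulVecLin).comap F'.mulVecLin := by
    rintro _ ⟨v, rfl⟩
    exact ⟨X' *ᵥ v, by simp [hX']⟩
  refine ⟨(LinearEquiv.ofLinearMap (Submodule.mapQ _ _ F.mulVecLin hle)
    (Submodule.mapQ _ _ F'.mulVecLin hle') ?_ ?_).toAddEquiv, fun x y hxy => ?_⟩
  · refine Submodule.linearMap_qext _ (LinearMap.ext fun v => ?_)
    refine (Submodule.Quotient.eq _).2 ⟨Y' *ᵥ v, ?_⟩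
    simp [← hY', sub_mulVec]
  · refine Submodule.linearMap_qext _ (LinearMap.ext fun v => ?_)
    refine (Submodule.Quotient.eq _).2 ⟨Y *ᵥ v, ?_⟩
    simp [← hY, sub_mulVec]
  · obtain ⟨z, hz⟩ := (Submodule.Quotient.eq _).1 hxy
    obtain ⟨q, hq⟩ := hB.even_dotProduct_mulVec z
    have hy : y = F *ᵥ x - B *ᵥ z := by
      rw [← mulVecLin_apply B, hz, mulVecLin_apply, sub_sub_cancel]
    refine ⟨z ⬝ᵥ F *ᵥ x - q, ?_⟩
    have hqQ := congrArg (Int.cast : ℤ → ℚ) hq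
    rw [intCast_dotProduct, map_intCast_mulVec] at hqQ
    have hyQ : (fun i => (y i : ℚ)) = F.map Int.cast *ᵥ (fun i => (x i : ℚ))
        - B.map Int.cast *ᵥ (fun i => (z i : ℚ)) := by
      rw [← map_intCast_mulVec, ← map_intCast_mulVec, hy]
      ext i
      simp
    have hBunit := isUnit_det_map_intCast (R := ℚ) hdet
    have hsymm : (B.map (Int.cast : ℤ → ℚ))ᵀ = B.map Int.cast := by
      exact congrArg (fun M : Matrix m m ℤ => M.map (Int.cast : ℤ → ℚ)) hB.1.eq
    rw [hyQ, ← hinv, Int.cast_sub, intCast_dotProduct, map_intCast_mulVec]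
    push_cast at hqQ
    generalize B.map (Int.cast : ℤ → ℚ) = b at *
    generalize F.map (Int.cast : ℤ → ℚ) = f at *
    generalize (fun i => (x i : ℚ)) = x at *
    generalize (fun i => (z i : ℚ)) = z at *
    have h1 : (f *ᵥ x) ⬝ᵥ z = z ⬝ᵥ f *ᵥ x := dotProduct_comm _ _
    have h2 : (b *ᵥ z) ⬝ᵥ b⁻¹ *ᵥ (f *ᵥ x) = z ⬝ᵥ f *ᵥ x := by
      rw [← hsymm, mulVec_transpose, ← dotProduct_mulVec, hsymm, mulVec_mulVec,
        mul_nonsing_inv _ hBunit, one_mulVec]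
    have h3 : x ⬝ᵥ (fᵀ * b⁻¹ * f) *ᵥ x = (f *ᵥ x) ⬝ᵥ b⁻¹ *ᵥ (f *ᵥ x) := by
      rw [← mulVec_mulVec, ← mulVec_mulVec, dotProduct_mulVec, vecMul_transpose]
    have h4 : (b *ᵥ z) ⬝ᵥ z = z ⬝ᵥ b *ᵥ z := dotProduct_comm _ _
    rw [h3]
    simp only [mulVec_sub, sub_dotProduct, dotProduct_sub, h2]
    rw [mulVec_mulVec z, nonsing_inv_mul _ hBunit, one_mulVec, h1, h4, hqQ]
    ring

theorem DiscEquiv.fromBlocks {A : Matrix n n ℤ} {E : Matrix m m ℤ} (hA : IsEven A)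
    (hE : IsEven E) (hdet : A.det ≠ 0) (hunit : IsUnit E.det) :
    DiscEquiv A (Matrix.fromBlocks A 0 0 E) := by
  obtain ⟨E', hEinv⟩ : ∃ E' : Matrix m m ℤ, E * E' = 1 := ⟨E⁻¹, mul_nonsing_inv _ hunit⟩
  have hAinv := mul_nonsing_inv _ (isUnit_det_map_intCast (R := ℚ) hdet)
  have hinv : ((Matrix.fromBlocks A 0 0 E).map (Int.cast : ℤ → ℚ))⁻¹ =
      Matrix.fromBlocks (A.map (Int.cast : ℤ → ℚ))⁻¹ 0 0 (E'.map Int.cast) := by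
    apply inv_eq_right_inv
    have hEinvQ : (E.map Int.cast : Matrix m m ℚ) * (E'.map Int.cast : Matrix m m ℚ) = 1 := by
      rw [← map_intCast_mul, hEinv]; simp
    simp [fromBlocks_map, fromBlocks_multiply, hAinv, hEinvQ]
  refine DiscEquiv.of_matrices (hA.fromBlocks hE) ?_ (fromRows 1 0) (fromCols 1 0)
    ⟨fromRows 1 0, ?_⟩ ⟨fromCols 1 0, ?_⟩ ⟨0, ?_⟩ ⟨Matrix.fromBlocks 0 0 0 (-E'), ?_⟩ ?_
  · rw [det_fromBlocks_zero₁₂]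
    exact mul_ne_zero hdet hunit.ne_zero
  · simp [fromRows_mul, fromBlocks_mul_fromRows]
  · simp [mul_fromCols, fromCols_mul_fromBlocks]
  · simp [fromCols_mul_fromRows]
  · rw [fromRows_mul_fromCols, ← fromBlocks_one, fromBlocks_multiply]
    rw [sub_eq_iff_eq_add, fromBlocks_add]
    simp [hEinv]
  · have h : (fromRows 1 0 : Matrix (n ⊕ m) n ℤ).map (Int.cast : ℤ → ℚ) = fromRows 1 0 := by
      ext (i | i) j <;> simp [one_apply]
    rw [hinv, h, transpose_fromRows, fromCols_mul_fromBlocks, fromCols_mul_fromRows]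
    simp

theorem det_transpose_mul_mul_ne_zero {A : Matrix n n ℤ} (hdet : A.det ≠ 0) {P : Matrix n m ℤ}
    {P' : Matrix m n ℤ} (h : P * P' = 1) (h' : P' * P = 1) : (Pᵀ * A * P).det ≠ 0 := by
  have hmul : Pᵀ * A * P * (P' * A.adjugate * P'ᵀ) = A.det • 1 :=
    calc Pᵀ * A * P * (P' * A.adjugate * P'ᵀ) = Pᵀ * A * (P * P') * A.adjugate * P'ᵀ := by
          simp only [Matrix.mul_assoc]
      _ = Pᵀ * (A * A.adjugate) * P'ᵀ := by rw [h, Matrix.mul_one, Matrix.mul_assoc Pᵀ]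
      _ = A.det • 1 := by
          rw [mul_adjugate, Matrix.mul_smul, Matrix.mul_one, Matrix.smul_mul, ← transpose_mul, h',
            transpose_one]
  have hdetmul := congrArg det hmul
  rw [det_mul, det_smul, det_one, mul_one] at hdetmul
  exact left_ne_zero_of_mul (hdetmul ▸ pow_ne_zero _ hdet)

theorem DiscEquiv.congr {A : Matrix n n ℤ} (hA : IsEven A) (hdet : A.det ≠ 0)
    {P : Matrix n m ℤ} {P' : Matrix m n ℤ} (h : P * P' = 1) (h' : P' * P = 1) :
    DiscEquiv A (Pᵀ * A * P) := by
  have ht : P'ᵀ * Pᵀ = 1 := by rw [← transpose_mul, h, transpose_one]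
  have ht' : Pᵀ * P'ᵀ = 1 := by rw [← transpose_mul, h', transpose_one]
  refine DiscEquiv.of_matrices (hA.transpose_mul_mul P)
    (det_transpose_mul_mul_ne_zero hdet h h') Pᵀ P'ᵀ ⟨P', ?_⟩ ⟨P, ?_⟩
    ⟨0, ?_⟩ ⟨0, ?_⟩ ?_
  · rw [Matrix.mul_assoc _ P, h, Matrix.mul_one]
  · rw [Matrix.mul_assoc, ← Matrix.mul_assoc, ht, Matrix.one_mul]
  · rw [ht, sub_self, Matrix.mul_zero]
  · rw [ht', sub_self, Matrix.mul_zero]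
  · have hQ : (P.map Int.cast : Matrix n m ℚ) * (P'.map Int.cast : Matrix m n ℚ) = 1 := by
      rw [← map_intCast_mul, h]; simp
    have hQ' : (P'.map Int.cast : Matrix m n ℚ) * (P.map Int.cast : Matrix n m ℚ) = 1 := by
      rw [← map_intCast_mul, h']; simp
    have hAinv := mul_nonsing_inv _ (isUnit_det_map_intCast (R := ℚ) hdet)
    rw [map_intCast_mul, map_intCast_mul, transpose_map (M := P)]
    generalize A.map (Int.cast : ℤ → ℚ) = a at *
    generalize P.map (Int.cast : ℤ → ℚ) = p at *
    generalize P'.map (Int.cast : ℤ → ℚ) = p' at *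
    have hQt : p'ᵀ * pᵀ = 1 := by rw [← transpose_mul, hQ, transpose_one]
    have hQt' : pᵀ * p'ᵀ = 1 := by rw [← transpose_mul, hQ', transpose_one]
    have hinv : (pᵀ * a * p)⁻¹ = p' * a⁻¹ * p'ᵀ := by
      apply inv_eq_right_inv
      calc pᵀ * a * p * (p' * a⁻¹ * p'ᵀ) = pᵀ * a * (p * p') * a⁻¹ * p'ᵀ := by
            simp only [Matrix.mul_assoc]
        _ = pᵀ * (a * a⁻¹) * p'ᵀ := by rw [hQ, Matrix.mul_one, Matrix.mul_assoc pᵀ]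
        _ = 1 := by rw [hAinv, Matrix.mul_one, hQt']
    rw [hinv, transpose_transpose]
    calc p * (p' * a⁻¹ * p'ᵀ) * pᵀ = (p * p') * a⁻¹ * (p'ᵀ * pᵀ) := by
          simp only [Matrix.mul_assoc]
      _ = a⁻¹ := by rw [hQ, hQt, Matrix.one_mul, Matrix.mul_one]

/-- An integral matrix with an integral left inverse can be completed to an invertible one by a
basis of the kernel of the left inverse. -/
theorem exists_complement {k n : Type*} [Fintype k] [Fintype n] [DecidableEq k] [DecidableEq n]
    {L : Matrix k n ℤ} {M : Matrix n k ℤ} (h : L * M = 1) :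
    ∃ (m : ℕ) (C : Matrix n (Fin m) ℤ) (R : Matrix (Fin m) n ℤ),
      L * C = 0 ∧ R * C = 1 ∧ R * M = 0 ∧ C * R + M * L = 1 := by
  let K := LinearMap.ker L.mulVecLin
  let b := Module.finBasis ℤ K
  let proj : (n → ℤ) →ₗ[ℤ] K :=
    LinearMap.codRestrict K (LinearMap.id - (M * L).mulVecLin) fun z => by
      simp [K, mulVec_sub, ← Matrix.mul_assoc, h]
  have hproj (z : n → ℤ) : (proj z : n → ℤ) = z - (M * L) *ᵥ z := rfl
  let R := LinearMap.toMatrix' (b.equivFun.toLinearMap ∘ₗ proj)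
  let C := LinearMap.toMatrix' (K.subtype ∘ₗ b.equivFun.symm.toLinearMap)
  have hR (z) : R *ᵥ z = b.equivFun (proj z) := by
    rw [LinearMap.toMatrix'_mulVec]; rfl
  have hC (t) : C *ᵥ t = b.equivFun.symm t := by
    rw [LinearMap.toMatrix'_mulVec]; rfl
  have hLC (t) : L *ᵥ (C *ᵥ t) = 0 := by
    rw [hC]; exact (b.equivFun.symm t).2
  refine ⟨_, C, R, ?_, ?_, ?_, ?_⟩ <;> refine ext_of_mulVec_single fun i => ?_
  · rw [← mulVec_mulVec, hLC, zero_mulVec]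
  · rw [← mulVec_mulVec, hR, one_mulVec]
    have : proj (C *ᵥ Pi.single i 1) = b.equivFun.symm (Pi.single i 1) := by
      apply Subtype.ext
      rw [hproj, ← mulVec_mulVec, hLC, mulVec_zero, sub_zero, hC]
    rw [this, LinearEquiv.apply_symm_apply]
  · rw [← mulVec_mulVec, hR, zero_mulVec]
    have : proj (M *ᵥ Pi.single i 1) = 0 := by
      apply Subtype.ext
      rw [hproj, mulVec_mulVec, Matrix.mul_assoc, h, Matrix.mul_one, sub_self]; rfl
    rw [this, map_zero]
  · rw [add_mulVec, ← mulVec_mulVec, hC, hR, LinearEquiv.symm_apply_apply, hproj, one_mulVec,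
      sub_add_cancel]

/-- Every integral symmetric matrix is diagonalizable over `ℚ`, by an integral matrix. -/
theorem exists_diagonal {n : ℕ} {A : Matrix (Fin n) (Fin n) ℤ} (hA : A.IsSymm) :
    ∃ (Q : Matrix (Fin n) (Fin n) ℤ) (d : Fin n → ℤ), Q.det ≠ 0 ∧ Qᵀ * A * Q = diagonal d := by
  let a : Matrix (Fin n) (Fin n) ℚ := A.map Int.cast
  have ha : a.IsSymm := congrArg (fun M : Matrix _ _ ℤ => M.map (Int.cast : ℤ → ℚ)) hA.eq
  have : Invertible (2 : ℚ) := invertibleOfNonzero two_ne_zero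
  obtain ⟨v₀, hv₀⟩ := LinearMap.BilinForm.exists_orthogonal_basis
    (LinearMap.BilinForm.isSymm_iff.1 (Matrix.isSymm_toBilin'_iff_isSymm.2 ha))
  let v := v₀.reindex (finCongr (Module.finrank_fin_fun ℚ))
  have hv (i j) (hij : i ≠ j) : v i ⬝ᵥ a *ᵥ v j = 0 := by
    have := hv₀ (i := (finCongr (Module.finrank_fin_fun ℚ)).symm i)
      (j := (finCongr (Module.finrank_fin_fun ℚ)).symm j) (by simpa using hij)
    rw [Function.onFun, Matrix.toBilin'_apply'] at this
    simpa [v] using this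
  obtain ⟨⟨b, hb⟩, hbv⟩ := IsLocalization.exist_integer_multiples_of_finite (nonZeroDivisors ℤ)
    fun p : Fin n × Fin n => v p.2 p.1
  choose q hq using hbv
  have hb0 : (b : ℚ) ≠ 0 := by exact_mod_cast nonZeroDivisors.ne_zero hb
  let r : Matrix (Fin n) (Fin n) ℚ := (Pi.basisFun ℚ (Fin n)).toMatrix v
  let Q : Matrix (Fin n) (Fin n) ℤ := Matrix.of fun i j => q (i, j)
  have hQ : Q.map (Int.cast : ℤ → ℚ) = (b : ℚ) • r := by
    ext i j
    simpa [Q, r, Module.Basis.toMatrix_apply] using hq (i, j)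
  have hr : r.det ≠ 0 := by
    have := (Pi.basisFun ℚ (Fin n)).invertibleToMatrix v
    exact (Matrix.isUnit_det_of_invertible r).ne_zero
  refine ⟨Q, fun i => (Qᵀ * A * Q) i i, fun h => ?_, ?_⟩
  · have := det_map_intCast (R := ℚ) Q
    rw [hQ, h, det_smul, Int.cast_zero] at this
    exact mul_ne_zero (pow_ne_zero _ hb0) hr this
  · ext i j
    rcases eq_or_ne i j with rfl | hij
    · simp
    rw [diagonal_apply_ne _ hij]
    have h : ((Qᵀ * A * Q).map (Int.cast : ℤ → ℚ)) i j = 0 := by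
      rw [map_intCast_mul, map_intCast_mul, transpose_map, hQ, transpose_smul,
        Matrix.mul_assoc, Matrix.smul_mul, Matrix.mul_smul, Matrix.mul_smul,
        Matrix.smul_apply, Matrix.smul_apply]
      exact (congrArg _ (congrArg _ (hv i j hij))).trans (by simp)
    simpa using h

theorem exists_E₈_vectors (k : ℕ) : ∃ w v : Fin 8 → ℤ,
    w ⬝ᵥ CartanMatrix.E₈ *ᵥ w = 2 * k + 2 ∧ v ⬝ᵥ CartanMatrix.E₈ *ᵥ w = 1 := by
  obtain ⟨a, b, c, d, h⟩ := Nat.sum_four_squares k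
  refine ⟨![0, a + d, b + d, 2 * d, c + d, 0, 1, 0], ![0, 0, 0, 0, 0, 0, 0, -1], ?_, ?_⟩
  · rw [← h]
    simp [CartanMatrix.E₈, dotProduct, mulVec, Fin.sum_univ_succ]
    ring
  · simp [CartanMatrix.E₈, dotProduct, mulVec, Fin.sum_univ_succ]

theorem E₈_dotProduct_mulVec_pos {x : Fin 8 → ℝ} (hx : x ≠ 0) :
    0 < x ⬝ᵥ CartanMatrix.E₈.map (Int.cast : ℤ → ℝ) *ᵥ x := by
  have key : x ⬝ᵥ CartanMatrix.E₈.map (Int.cast : ℤ → ℝ) *ᵥ x =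
      2 * (x 0 - x 2 / 2) ^ 2 + 3 / 2 * (x 2 - 2 / 3 * x 3) ^ 2 + 2 * (x 1 - x 3 / 2) ^ 2
      + 2 * (x 7 - x 6 / 2) ^ 2 + 3 / 2 * (x 6 - 2 / 3 * x 5) ^ 2
      + 4 / 3 * (x 5 - 3 / 4 * x 4) ^ 2 + 5 / 4 * (x 4 - 4 / 5 * x 3) ^ 2 + 1 / 30 * x 3 ^ 2 := by
    simp [CartanMatrix.E₈, dotProduct, mulVec, Fin.sum_univ_eight]
    ring
  rw [key]
  refine lt_of_le_of_ne (by positivity) fun h => hx ?_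
  have null {a b c d e f g t : ℝ} (h : 0 = 2 * a ^ 2 + 3 / 2 * b ^ 2 + 2 * c ^ 2 + 2 * d ^ 2
      + 3 / 2 * e ^ 2 + 4 / 3 * f ^ 2 + 5 / 4 * g ^ 2 + 1 / 30 * t ^ 2) :
      a = 0 ∧ b = 0 ∧ c = 0 ∧ d = 0 ∧ e = 0 ∧ f = 0 ∧ g = 0 ∧ t = 0 := by
    have ha := sq_nonneg a
    have hb := sq_nonneg b
    have hc := sq_nonneg c
    have hd := sq_nonneg d
    have he := sq_nonneg e
    have hf := sq_nonneg f
    have hg := sq_nonneg g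
    have ht := sq_nonneg t
    refine ⟨?_, ?_, ?_, ?_, ?_, ?_, ?_, ?_⟩ <;>
      exact (pow_eq_zero_iff two_ne_zero).1 (by linarith)
  obtain ⟨h0, h2, h1, h7, h6, h5, h4, h3⟩ := null h
  funext i
  fin_cases i <;> simp only [Fin.zero_eta, Fin.mk_one, Fin.reduceFinMk, Pi.zero_apply] <;> linarith

theorem exists_dotProduct_mulVec_eq {ι : Type*} [Fintype ι] [DecidableEq ι] (k : ι → ℕ) :
    ∃ W V : Matrix (Fin 8 × ι) ι ℤ,
      Wᵀ * blockDiagonal (fun _ : ι => CartanMatrix.E₈) * W =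
        diagonal (fun i => 2 * (k i : ℤ) + 2) ∧
      Vᵀ * blockDiagonal (fun _ : ι => CartanMatrix.E₈) * W = 1 := by
  choose w v hw hv using fun i => exists_E₈_vectors (k i)
  have key (f g : ι → Fin 8 → ℤ) :
      (Matrix.of fun (p : Fin 8 × ι) j => if p.2 = j then f j p.1 else 0)ᵀ *
        blockDiagonal (fun _ : ι => CartanMatrix.E₈) *
        (Matrix.of fun (p : Fin 8 × ι) j => if p.2 = j then g j p.1 else 0) =
      diagonal fun i => f i ⬝ᵥ CartanMatrix.E₈ *ᵥ g i := by
    rw [Matrix.mul_assoc]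
    ext i j
    simp [mul_apply, Fintype.sum_prod_type, blockDiagonal_apply, diagonal_apply, dotProduct, mulVec]
    simp only [eq_comm (a := j)]
    split_ifs with h
    · rw [h]
    · rfl
  exact ⟨_, _, (key w w).trans (by simp [hw]), (key v w).trans (by simp [hv])⟩

theorem isEven_blockDiagonal_E₈ {ι : Type*} [DecidableEq ι] :
    IsEven (blockDiagonal fun _ : ι => CartanMatrix.E₈) := by
  refine ⟨?_, fun i => ?_⟩
  · rw [Matrix.IsSymm, blockDiagonal_transpose]
    simp only [CartanMatrix.E₈_isSymm.eq]
  · simp [blockDiagonal_apply, CartanMatrix.E₈_diag]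

theorem blockDiagonal_E₈_pos {ι : Type*} [Fintype ι] [DecidableEq ι] {x : Fin 8 × ι → ℝ}
    (hx : x ≠ 0) :
    0 < x ⬝ᵥ (blockDiagonal (fun _ : ι => CartanMatrix.E₈)).map (Int.cast : ℤ → ℝ) *ᵥ x := by
  have expand : x ⬝ᵥ (blockDiagonal (fun _ : ι => CartanMatrix.E₈)).map (Int.cast : ℤ → ℝ) *ᵥ x =
      ∑ i, (fun a => x (a, i)) ⬝ᵥ CartanMatrix.E₈.map (Int.cast : ℤ → ℝ) *ᵥ fun a => x (a, i) := by
    simp [mulVec, Fintype.sum_prod_type_right, blockDiagonal_apply, dotProduct]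
  obtain ⟨⟨a, i⟩, ha⟩ := Function.ne_iff.1 hx
  rw [expand]
  refine Finset.sum_pos' (fun j _ => ?_) ⟨i, Finset.mem_univ _,
    E₈_dotProduct_mulVec_pos fun h => ha (congrFun h a)⟩
  by_cases hj : (fun a => x (a, j)) = 0
  · simp [hj]
  · exact (E₈_dotProduct_mulVec_pos hj).le

/-- A unimodular sublattice, spanned by the columns of `M`, splits off. -/
theorem exists_discEquiv_of_isUnit_det {k n : Type*} [Fintype k] [Fintype n] [DecidableEq k]
    [DecidableEq n] {G : Matrix n n ℤ} (hG : IsEven G) (hdet : G.det ≠ 0) {M : Matrix n k ℤ}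
    (hM : IsUnit (Mᵀ * G * M).det) :
    ∃ (m : ℕ) (C : Matrix n (Fin m) ℤ) (R : Matrix (Fin m) n ℤ),
      DiscEquiv G (Cᵀ * G * C) ∧ Mᵀ * G * C = 0 ∧ R * C = 1 := by
  obtain ⟨m, C, R, hLC, hRC, hRM, hCR⟩ := exists_complement
    (L := (Mᵀ * G * M)⁻¹ * (Mᵀ * G)) (M := M) (by rw [Matrix.mul_assoc, nonsing_inv_mul _ hM])
  have hMGC : Mᵀ * G * C = 0 := by
    rw [Matrix.mul_assoc _ (Mᵀ * G)] at hLC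
    rw [← Matrix.one_mul (Mᵀ * G * C), ← mul_nonsing_inv _ hM, Matrix.mul_assoc, hLC,
      Matrix.mul_zero]
  have hCGM : Cᵀ * G * M = 0 := by
    rw [← transpose_eq_zero, ← hMGC]
    simp [transpose_mul, hG.1.eq, Matrix.mul_assoc]
  have hP : fromCols C M * fromRows R ((Mᵀ * G * M)⁻¹ * (Mᵀ * G)) = 1 := by
    rw [fromCols_mul_fromRows, hCR]
  have hP' : fromRows R ((Mᵀ * G * M)⁻¹ * (Mᵀ * G)) * fromCols C M = 1 := by
    rw [fromRows_mul_fromCols, hRC, hRM, hLC, Matrix.mul_assoc, nonsing_inv_mul _ hM,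
      fromBlocks_one]
  have hblocks : (fromCols C M)ᵀ * G * fromCols C M =
      Matrix.fromBlocks (Cᵀ * G * C) 0 0 (Mᵀ * G * M) := by
    rw [transpose_fromCols, fromRows_mul, fromRows_mul_fromCols, hMGC, hCGM]
  have hdet' := det_transpose_mul_mul_ne_zero hdet hP hP'
  have hequiv := DiscEquiv.congr hG hdet hP hP'
  rw [hblocks] at hequiv hdet'
  rw [det_fromBlocks_zero₁₂] at hdet'
  exact ⟨m, C, R, hequiv.trans (DiscEquiv.fromBlocks (hG.transpose_mul_mul C)
    (hG.transpose_mul_mul M) (left_ne_zero_of_mul hdet') hM).symm, hMGC, hRC⟩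

/-- If the columns of `q` diagonalize `a`, and the columns of `w` have the opposite norms to a set
`s` of columns of `q` containing those of negative norm, then `a ⊕ e` is positive definite on the
orthogonal complement of the sums of corresponding columns and of the columns of a matrix `v`
pairing perfectly with `w`. -/
theorem add_pos_of_orthogonal {n p : Type*} [Fintype n] [Fintype p] [DecidableEq n]
    {a q : Matrix n n ℝ} {e : Matrix p p ℝ} {d : n → ℝ} {s : n → Prop}
    [DecidablePred s] {w v : Matrix p {i // s i} ℝ}
    (hq : IsUnit q.det) (hd : ∀ i, ¬ s i → 0 < d i) (hqa : qᵀ * a * q = diagonal d) (he : e.IsSymm)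
    (hpos : ∀ x, x ≠ 0 → 0 < x ⬝ᵥ e *ᵥ x) (hw : wᵀ * e * w = diagonal fun i : {i // s i} => -d i)
    (hv : vᵀ * e * w = 1) {x : n → ℝ} {y : p → ℝ}
    (hxy : ∀ i : {i // s i}, ((qᵀ * a) *ᵥ x) i + ((wᵀ * e) *ᵥ y) i = 0)
    (hy : (vᵀ * e) *ᵥ y = 0) (hne : x ≠ 0 ∨ y ≠ 0) : 0 < x ⬝ᵥ a *ᵥ x + y ⬝ᵥ e *ᵥ y := by
  obtain ⟨c, rfl⟩ : ∃ c, x = q *ᵥ c :=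
    ⟨q⁻¹ *ᵥ x, by rw [mulVec_mulVec, mul_nonsing_inv _ hq, one_mulVec]⟩
  let c' : {i // s i} → ℝ := fun i => c i
  obtain ⟨z, rfl⟩ : ∃ z, y = w *ᵥ c' + z := ⟨y - w *ᵥ c', by rw [add_sub_cancel]⟩
  have hz : (wᵀ * e) *ᵥ z = 0 := by
    funext i
    have := hxy i
    rw [mulVec_mulVec, hqa, mulVec_add, mulVec_mulVec, hw, Pi.add_apply, mulVec_diagonal,
      mulVec_diagonal] at this
    simp only [c'] at this
    rw [Pi.zero_apply]
    linarith
  have hx : (q *ᵥ c) ⬝ᵥ a *ᵥ (q *ᵥ c) = ∑ i, d i * c i ^ 2 := by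
    rw [mulVec_mulVec, ← vecMul_transpose, ← dotProduct_mulVec, mulVec_mulVec, ← Matrix.mul_assoc,
      hqa]
    exact Finset.sum_congr rfl fun i _ => by rw [mulVec_diagonal]; ring
  have hw' : (w *ᵥ c') ⬝ᵥ e *ᵥ (w *ᵥ c') = ∑ i : {i // s i}, -(d i * c i ^ 2) := by
    rw [mulVec_mulVec, ← vecMul_transpose, ← dotProduct_mulVec, mulVec_mulVec, ← Matrix.mul_assoc,
      hw]
    exact Finset.sum_congr rfl fun i _ => by rw [mulVec_diagonal]; ring
  have hwz : (w *ᵥ c') ⬝ᵥ e *ᵥ z = 0 := by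
    rw [← vecMul_transpose, ← dotProduct_mulVec, mulVec_mulVec, hz, dotProduct_zero]
  have hzw : z ⬝ᵥ e *ᵥ (w *ᵥ c') = 0 := by
    rw [dotProduct_mulVec, ← mulVec_transpose, he.eq, dotProduct_comm, hwz]
  have hsum : (q *ᵥ c) ⬝ᵥ a *ᵥ (q *ᵥ c) + (w *ᵥ c' + z) ⬝ᵥ e *ᵥ (w *ᵥ c' + z) =
      ∑ i : {i // ¬ s i}, d i * c i ^ 2 + z ⬝ᵥ e *ᵥ z := by
    rw [mulVec_add, dotProduct_add, add_dotProduct, add_dotProduct, hx, hw', hwz, hzw,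
      ← Fintype.sum_subtype_add_sum_subtype (s), Finset.sum_neg_distrib]
    ring
  have hnonneg (i : {i // ¬ s i}) : 0 ≤ d i * c i ^ 2 :=
    mul_nonneg (hd i i.2).le (sq_nonneg _)
  rw [hsum]
  rcases eq_or_ne z 0 with rfl | hz0
  · have hc' : c' = 0 := by
      rw [← one_mulVec c', ← hv, ← mulVec_mulVec, ← hy, add_zero]
    rw [hc'] at hne
    have hc : c ≠ 0 := by
      rintro rfl
      simp at hne
    obtain ⟨i, hi⟩ := Function.ne_iff.1 hc
    have hdi : ¬ s i := fun h => hi (congrFun hc' ⟨i, h⟩)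
    rw [zero_dotProduct, add_zero]
    exact Finset.sum_pos' (fun j _ => hnonneg j) ⟨⟨i, hdi⟩, Finset.mem_univ _,
      mul_pos (hd i hdi) (sq_pos_iff.2 hi)⟩
  · exact add_pos_of_nonneg_of_pos (Finset.sum_nonneg fun j _ => hnonneg j) (hpos z hz0)

end EvenLattice
/-- Every nondegenerate even lattice has the same discriminant form
(including its `ℚ/ℤ`-valued quadratic form) as some positive definite even lattice:
for every symmetric `A ∈ Mat_n(ℤ)` with even diagonal and `det A ≠ 0` there exist `m`,
a positive definite symmetric `B ∈ Mat_m(ℤ)` with even diagonal, and an isomorphism of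
abelian groups `ψ : ℤⁿ/Aℤⁿ → ℤᵐ/Bℤᵐ` such that whenever `ψ([x]) = [y]` one has
`xᵀA⁻¹x/2 − yᵀB⁻¹y/2 ∈ ℤ`. -/
theorem exists_positive_definite_with_same_discriminant_form
    (n : ℕ) (A : Matrix (Fin n) (Fin n) ℤ)
    (hSym : A.IsSymm) (hEven : ∀ i, Even (A i i)) (hdet : A.det ≠ 0) :
    ∃ (m : ℕ) (B : Matrix (Fin m) (Fin m) ℤ),
      B.IsSymm ∧ (∀ i, Even (B i i)) ∧ (B.map (Int.cast : ℤ → ℝ)).PosDef ∧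
      ∃ ψ : ((Fin n → ℤ) ⧸ LinearMap.range A.mulVecLin) ≃+
            ((Fin m → ℤ) ⧸ LinearMap.range B.mulVecLin),
        ∀ (x : Fin n → ℤ) (y : Fin m → ℤ),
          ψ (Submodule.Quotient.mk x) = Submodule.Quotient.mk y →
          ∃ k : ℤ,
            ((fun i => (x i : ℚ)) ⬝ᵥ ((A.map (Int.cast : ℤ → ℚ))⁻¹).mulVec
                (fun i => (x i : ℚ))) / 2
            - ((fun i => (y i : ℚ)) ⬝ᵥ ((B.map (Int.cast : ℤ → ℚ))⁻¹).mulVec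
                (fun i => (y i : ℚ))) / 2 = (k : ℚ) := by
  have hA : EvenLattice.IsEven A := ⟨hSym, hEven⟩
  obtain ⟨Q, d, hQ, hQA⟩ := EvenLattice.exists_diagonal hSym
  have hd (i : Fin n) : d i ≠ 0 := by
    have hprod := congrArg det hQA
    rw [det_mul, det_mul, det_transpose, det_diagonal] at hprod
    exact Finset.prod_ne_zero_iff.1 (hprod ▸ mul_ne_zero (mul_ne_zero hQ hdet) hQ) i
      (Finset.mem_univ i)
  have hdEven (i : Fin n) : Even (d i) := by
    simpa [hQA] using (hA.transpose_mul_mul Q).2 i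
  have hk (i : {i // d i < 0}) : ∃ k : ℕ, 2 * (k : ℤ) + 2 = -d i := by
    obtain ⟨r, hr⟩ := hdEven i
    exact ⟨(-r - 1).toNat, by have := i.2; omega⟩
  choose k hk using hk
  obtain ⟨W, V, hW, hV⟩ := EvenLattice.exists_dotProduct_mulVec_eq k
  simp only [hk] at hW
  let E : Matrix (Fin 8 × {i // d i < 0}) (Fin 8 × {i // d i < 0}) ℤ :=
    blockDiagonal fun _ => CartanMatrix.E₈
  have hE : EvenLattice.IsEven E := EvenLattice.isEven_blockDiagonal_E₈
  have hEdet : E.det = 1 := by simp [E, det_blockDiagonal, CartanMatrix.E₈_det]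
  let M : Matrix (Fin n ⊕ Fin 8 × {i // d i < 0}) ({i // d i < 0} ⊕ {i // d i < 0}) ℤ :=
    fromBlocks (Q.submatrix id Subtype.val) 0 W V
  have hMG : Mᵀ * fromBlocks A 0 0 E =
      fromBlocks ((Qᵀ * A).submatrix Subtype.val id) (Wᵀ * E) 0 (Vᵀ * E) := by
    simp [M, fromBlocks_transpose, fromBlocks_multiply]
    rfl
  have hM : IsUnit (Mᵀ * fromBlocks A 0 0 E * M).det := by
    have hWV : Wᵀ * E * V = 1 := by
      rw [← transpose_one, ← hV]
      simp [E, transpose_mul, hE.1.eq, Matrix.mul_assoc]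
    have hgram : Mᵀ * fromBlocks A 0 0 E * M = fromBlocks 0 1 1 (Vᵀ * E * V) := by
      have hQ' : (Qᵀ * A).submatrix (Subtype.val : {i // d i < 0} → Fin n) id *
          Q.submatrix id Subtype.val = diagonal fun i : {i // d i < 0} => d i := by
        rw [← submatrix_mul _ _ _ _ _ Function.bijective_id, hQA,
          submatrix_diagonal _ _ Subtype.val_injective]
        rfl
      rw [hMG, fromBlocks_multiply, hQ', hW, hWV, hV, diagonal_add]
      simp
    have hinv : Mᵀ * fromBlocks A 0 0 E * M * fromBlocks (-(Vᵀ * E * V)) 1 1 0 = 1 := by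
      rw [hgram, fromBlocks_multiply, ← fromBlocks_one]
      simp
    exact isUnit_det_of_right_inverse hinv
  obtain ⟨m, C, R, hequiv, hMGC, hRC⟩ := EvenLattice.exists_discEquiv_of_isUnit_det
    (hA.fromBlocks hE) (by simpa [hEdet] using hdet) hM
  have hB := (hA.fromBlocks hE).transpose_mul_mul C
  refine ⟨m, _, hB.1, hB.2, Matrix.PosDef.of_dotProduct_mulVec_pos ?_ fun t ht => ?_,
    (EvenLattice.DiscEquiv.fromBlocks hA hE hdet (by simp [hEdet])).trans hequiv⟩
  · exact congrArg (fun S : Matrix (Fin m) (Fin m) ℤ => S.map (Int.cast : ℤ → ℝ)) hB.1.eq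
  · let z : Fin n ⊕ Fin 8 × {i // d i < 0} → ℝ := C.map Int.cast *ᵥ t
    have hz : z ≠ 0 := by
      intro h
      have hRCt : (R.map Int.cast : Matrix _ _ ℝ) *ᵥ z = t := by
        rw [mulVec_mulVec, ← EvenLattice.map_intCast_mul, hRC]
        simp
      exact ht (by rw [← hRCt, h, mulVec_zero])
    have hform : star t ⬝ᵥ (Cᵀ * fromBlocks A 0 0 E * C).map (Int.cast : ℤ → ℝ) *ᵥ t =
        (z ∘ Sum.inl) ⬝ᵥ A.map (Int.cast : ℤ → ℝ) *ᵥ (z ∘ Sum.inl) +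
        (z ∘ Sum.inr) ⬝ᵥ E.map (Int.cast : ℤ → ℝ) *ᵥ (z ∘ Sum.inr) := by
      rw [EvenLattice.map_intCast_mul, EvenLattice.map_intCast_mul, transpose_map (M := C),
        ← mulVec_mulVec, ← mulVec_mulVec, dotProduct_mulVec, vecMul_transpose, fromBlocks_map,
        fromBlocks_mulVec, star_trivial]
      simp [z, dotProduct]
    have horth : (fromBlocks ((Qᵀ * A).submatrix Subtype.val id) (Wᵀ * E) 0 (Vᵀ * E)).map
        (Int.cast : ℤ → ℝ) *ᵥ z = 0 := by
      rw [mulVec_mulVec, ← EvenLattice.map_intCast_mul, ← hMG, hMGC]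
      simp
    rw [fromBlocks_map, fromBlocks_mulVec] at horth
    rw [hform]
    refine EvenLattice.add_pos_of_orthogonal (q := Q.map Int.cast) (d := fun i => d i)
      (s := fun i => d i < 0) (w := W.map Int.cast) (v := V.map Int.cast)
      (EvenLattice.isUnit_det_map_intCast hQ) (fun i hi => ?_) ?_ ?_
      (fun x hx => EvenLattice.blockDiagonal_E₈_pos hx) ?_ ?_ (fun i => ?_) ?_ ?_
    · exact_mod_cast (not_lt.1 hi).lt_of_ne' (hd i)
    · rw [← transpose_map (M := Q), ← EvenLattice.map_intCast_mul, ← EvenLattice.map_intCast_mul,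
        hQA, diagonal_map Int.cast_zero]
    · exact congrArg (fun S : Matrix _ _ ℤ => S.map (Int.cast : ℤ → ℝ)) hE.1.eq
    · rw [← transpose_map (M := W), ← EvenLattice.map_intCast_mul, ← EvenLattice.map_intCast_mul,
        hW, diagonal_map Int.cast_zero]
      simp
    · rw [← transpose_map (M := V), ← EvenLattice.map_intCast_mul, ← EvenLattice.map_intCast_mul,
        hV]
      simp
    · rw [← transpose_map (M := W), ← EvenLattice.map_intCast_mul, ← transpose_map (M := Q),
        ← EvenLattice.map_intCast_mul]
      exact congrFun horth (Sum.inl i)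
    · rw [← transpose_map (M := V), ← EvenLattice.map_intCast_mul]
      funext i
      simpa using congrFun horth (Sum.inr i)
    · by_contra! h
      exact hz (by rw [← Sum.elim_comp_inl_inr z, h.1, h.2]; simp)
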